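/- Let X be any real Banach space and let F : [0,1] → (nonempty bounded subsets of X) be a multifunction such that conv F : t ↦ conv(F(t)) is Riemann integrable and its Riemann integral A = ∫₀¹ conv F(t) dt is compact. Then F is Riemann integrable and ∫₀¹ F(t) dt = A. -/

import Mathlib

open Pointwise

/-- A tagged partition of the interval `[0,1]`: subdivision points
`x 0 = 0 ≤ x 1 ≤ … ≤ x n = 1` together with tags `t i ∈ [x i, x (i+1)]`. -/
structure TaggedPartition where
  n : ℕ
  npos : 0 < n
  x : Fin (n + 1) → ℝ
  t : Fin n → ℝ
  mono : Monotone x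
  x_zero : x 0 = 0
  x_last : x (Fin.last n) = 1
  tag_mem : ∀ i : Fin n, t i ∈ Set.Icc (x i.castSucc) (x i.succ)

/-- The mesh `d(T)` of a tagged partition: the largest length of a subinterval. -/
noncomputable def TaggedPartition.mesh (T : TaggedPartition) : ℝ :=
  ⨆ i : Fin T.n, (T.x i.succ - T.x i.castSucc)

/-- The Riemann sum `S(F,T) = ∑ |Δ i| • F (t i)` of a multifunction `F`,
where the sum of sets is the Minkowski sum. -/
noncomputable def setRiemannSum {X : Type*} [NormedAddCommGroup X] [NormedSpace ℝ X]
    (F : ℝ → Set X) (T : TaggedPartition) : Set X :=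
  ∑ i : Fin T.n, (T.x i.succ - T.x i.castSucc) • F (T.t i)

/-- A closed bounded nonempty set `A` is the Riemann integral of the multifunction `F` if
the Riemann sums of `F` converge to `A` in the Hausdorff distance as the mesh tends to `0`. -/
def IsSetRiemannIntegral {X : Type*} [NormedAddCommGroup X] [NormedSpace ℝ X]
    (F : ℝ → Set X) (A : Set X) : Prop :=
  A.Nonempty ∧ IsClosed A ∧ Bornology.IsBounded A ∧
    ∀ ε > 0, ∃ δ > 0, ∀ T : TaggedPartition, T.mesh < δ →
      Metric.hausdorffDist (setRiemannSum F T) A < ε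

/-- A multifunction is Riemann integrable if it has a Riemann integral. -/
def SetRiemannIntegrable {X : Type*} [NormedAddCommGroup X] [NormedSpace ℝ X]
    (F : ℝ → Set X) : Prop :=
  ∃ A : Set X, IsSetRiemannIntegral F A

/-- `F` is a multifunction on `[0,1]` with nonempty bounded values. -/
def IsMultifunction {X : Type*} [NormedAddCommGroup X] (F : ℝ → Set X) : Prop :=
  ∀ t ∈ Set.Icc (0 : ℝ) 1, (F t).Nonempty ∧ Bornology.IsBounded (F t)

/-- Telescoping sums over `Fin n`. -/
theorem Fin.sum_succ_sub_castSucc {M : Type*} [AddCommGroup M] (n : ℕ) (x : Fin (n + 1) → M) :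
    ∑ i : Fin n, (x i.succ - x i.castSucc) = x (Fin.last n) - x 0 := by
  induction n with
  | zero => simp
  | succ n ih =>
    have h := ih fun i => x i.castSucc
    simp only [← Fin.succ_castSucc] at h
    rw [Fin.sum_univ_castSucc]
    simp [h]

namespace TaggedPartition

theorem length_nonneg (T : TaggedPartition) (i : Fin T.n) :
    0 ≤ T.x i.succ - T.x i.castSucc :=
  sub_nonneg.2 (T.mono (Fin.castSucc_lt_succ).le)

theorem length_le_mesh (T : TaggedPartition) (i : Fin T.n) :
    T.x i.succ - T.x i.castSucc ≤ T.mesh :=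
  le_ciSup (f := fun i : Fin T.n => T.x i.succ - T.x i.castSucc) (Set.finite_range _).bddAbove i

theorem sum_length (T : TaggedPartition) :
    ∑ i : Fin T.n, (T.x i.succ - T.x i.castSucc) = 1 := by
  rw [Fin.sum_succ_sub_castSucc, T.x_last, T.x_zero, sub_zero]

theorem tag_mem_unitInterval (T : TaggedPartition) (i : Fin T.n) :
    T.t i ∈ Set.Icc (0 : ℝ) 1 := by
  have h := T.tag_mem i
  refine ⟨?_, ?_⟩
  · rw [← T.x_zero]
    exact (T.mono (Fin.zero_le _)).trans h.1
  · rw [← T.x_last]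
    exact h.2.trans (T.mono (Fin.le_last _))

theorem sum_length_sq_le_mesh (T : TaggedPartition) :
    ∑ i : Fin T.n, (T.x i.succ - T.x i.castSucc) ^ 2 ≤ T.mesh := by
  calc ∑ i : Fin T.n, (T.x i.succ - T.x i.castSucc) ^ 2
      ≤ ∑ i : Fin T.n, T.mesh * (T.x i.succ - T.x i.castSucc) := by
        refine Finset.sum_le_sum fun i _ => ?_
        rw [sq]
        exact mul_le_mul_of_nonneg_right (T.length_le_mesh i) (T.length_nonneg i)
    _ = T.mesh := by rw [← Finset.mul_sum, T.sum_length, mul_one]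

/-- Every point of `[0,1]` is a tag of a partition into `N` intervals of equal length. -/
theorem exists_uniform_tag {N : ℕ} (hN : 0 < N) {t : ℝ} (ht : t ∈ Set.Icc (0 : ℝ) 1) :
    ∃ T : TaggedPartition, T.mesh = 1 / N ∧
      ∃ i : Fin T.n, T.t i = t ∧ T.x i.succ - T.x i.castSucc = 1 / N := by
  have hN' : (0 : ℝ) < N := by exact_mod_cast hN
  let x : Fin (N + 1) → ℝ := fun i => (i : ℕ) / (N : ℝ)
  have hmono : Monotone x := fun i j hij =>
    div_le_div_of_nonneg_right (by exact_mod_cast hij) hN'.le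
  have hlen : ∀ i : Fin N, x i.succ - x i.castSucc = 1 / N := fun i => by
    simp only [x, Fin.val_succ, Fin.val_castSucc]
    push_cast
    ring
  let T : TaggedPartition :=
    { n := N
      npos := hN
      x := x
      t := fun i => max (x i.castSucc) (min t (x i.succ))
      mono := hmono
      x_zero := by simp [x]
      x_last := by simp [x, hN'.ne']
      tag_mem := fun i =>
        ⟨le_max_left _ _, max_le (hmono (Fin.castSucc_lt_succ).le) (min_le_right _ _)⟩ }
  have : Nonempty (Fin N) := ⟨⟨0, hN⟩⟩
  refine ⟨T, ?_, ?_⟩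
  · change ⨆ i : Fin N, (x i.succ - x i.castSucc) = 1 / N
    simp only [hlen, ciSup_const]
  · obtain ⟨i, hi⟩ : ∃ i : Fin N, t ∈ Set.Icc (x i.castSucc) (x i.succ) := by
      rcases ht.2.eq_or_lt with rfl | h1
      · refine ⟨⟨N - 1, by omega⟩, ?_, ?_⟩
        · simp only [x, Fin.val_castSucc]
          rw [div_le_one hN']
          exact_mod_cast Nat.sub_le _ _
        · simp only [x, Fin.val_succ]
          rw [Nat.sub_add_cancel hN, div_self hN'.ne']
      · have h0 : 0 ≤ t * N := mul_nonneg ht.1 hN'.le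
        refine ⟨⟨⌊t * N⌋₊, (Nat.floor_lt h0).2 (by nlinarith)⟩, ?_, ?_⟩
        · simp only [x, Fin.val_castSucc]
          rw [div_le_iff₀ hN']
          exact Nat.floor_le h0
        · simp only [x, Fin.val_succ]
          rw [le_div_iff₀ hN']
          push_cast
          exact (Nat.lt_floor_add_one _).le
    refine ⟨i, ?_, hlen i⟩
    change max (x i.castSucc) (min t (x i.succ)) = t
    rw [min_eq_left hi.2, max_eq_right hi.1]

end TaggedPartition

section

variable {X : Type*} [NormedAddCommGroup X] [NormedSpace ℝ X]

theorem mem_setRiemannSum {F : ℝ → Set X} {T : TaggedPartition} {z : X} :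
    z ∈ setRiemannSum F T ↔ ∃ y : Fin T.n → X, (∀ i, y i ∈ F (T.t i)) ∧
      ∑ i, (T.x i.succ - T.x i.castSucc) • y i = z := by
  rw [setRiemannSum, Set.mem_fintype_sum]
  constructor
  · rintro ⟨g, hg, rfl⟩
    choose y hy hyg using fun i => Set.mem_smul_set.1 (hg i)
    exact ⟨y, hy, by simp only [hyg]⟩
  · rintro ⟨y, hy, rfl⟩
    exact ⟨_, fun i => Set.smul_mem_smul_set (hy i), rfl⟩

theorem IsMultifunction.setRiemannSum_nonempty {F : ℝ → Set X} (hF : IsMultifunction F)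
    (T : TaggedPartition) : (setRiemannSum F T).Nonempty := by
  choose y hy using fun i => (hF _ (T.tag_mem_unitInterval i)).1
  exact ⟨_, mem_setRiemannSum.2 ⟨y, hy, rfl⟩⟩

theorem IsMultifunction.isBounded_setRiemannSum {F : ℝ → Set X} (hF : IsMultifunction F)
    (T : TaggedPartition) : Bornology.IsBounded (setRiemannSum F T) := by
  choose C hC using fun i => (hF _ (T.tag_mem_unitInterval i)).2.exists_norm_le
  refine isBounded_iff_forall_norm_le.2
    ⟨∑ i, (T.x i.succ - T.x i.castSucc) * C i, fun z hz => ?_⟩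
  obtain ⟨y, hy, rfl⟩ := mem_setRiemannSum.1 hz
  refine norm_sum_le_of_le _ fun i _ => ?_
  rw [norm_smul, Real.norm_of_nonneg (T.length_nonneg i)]
  exact mul_le_mul_of_nonneg_left (hC i _ (hy i)) (T.length_nonneg i)

theorem IsMultifunction.convexHull {F : ℝ → Set X} (hF : IsMultifunction F) :
    IsMultifunction fun t => convexHull ℝ (F t) := fun t ht =>
  ⟨(hF t ht).1.convexHull, isBounded_convexHull.2 (hF t ht).2⟩

theorem IsMultifunction.hausdorffEDist_setRiemannSum_ne_top {F : ℝ → Set X}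
    (hF : IsMultifunction F) {A : Set X} (hne : A.Nonempty) (hb : Bornology.IsBounded A)
    (T : TaggedPartition) : Metric.hausdorffEDist (setRiemannSum F T) A ≠ ⊤ :=
  Metric.hausdorffEDist_ne_top_of_nonempty_of_bounded (hF.setRiemannSum_nonempty T) hne
    (hF.isBounded_setRiemannSum T) hb

/-- The values of a Riemann integrable multifunction have uniformly bounded diameters. -/
theorem IsSetRiemannIntegral.exists_forall_norm_sub_le {G : ℝ → Set X} {A : Set X}
    (hG : IsMultifunction G) (h : IsSetRiemannIntegral G A) :
    ∃ M : ℝ, ∀ t ∈ Set.Icc (0 : ℝ) 1, ∀ u ∈ G t, ∀ v ∈ G t, ‖u - v‖ ≤ M := by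
  obtain ⟨hne, -, hb, hA⟩ := h
  obtain ⟨δ, hδ, hA⟩ := hA 1 one_pos
  obtain ⟨n, hn⟩ := exists_nat_one_div_lt hδ
  refine ⟨(n + 1 : ℕ) * (Metric.diam A + 2), fun t ht u hu v hv => ?_⟩
  obtain ⟨T, hmesh, i, hi, hlen⟩ := TaggedPartition.exists_uniform_tag n.succ_pos ht
  have hT := hA T (by rw [hmesh]; exact_mod_cast hn)
  choose w hw using fun j => (hG _ (T.tag_mem_unitInterval j)).1
  have key : ∀ u ∈ G t, ∀ j, Function.update w i u j ∈ G (T.t j) := by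
    intro u hu j
    rcases eq_or_ne j i with rfl | hj
    · simpa [hi] using hu
    · simpa [hj] using hw j
  have hfin := hG.hausdorffEDist_setRiemannSum_ne_top hne hb T
  obtain ⟨a, ha, hau⟩ := Metric.exists_dist_lt_of_hausdorffDist_lt
    (mem_setRiemannSum.2 ⟨_, key u hu, rfl⟩) hT hfin
  obtain ⟨b, hb', hbv⟩ := Metric.exists_dist_lt_of_hausdorffDist_lt
    (mem_setRiemannSum.2 ⟨_, key v hv, rfl⟩) hT hfin
  have hab := Metric.dist_le_diam_of_mem hb ha hb'
  have hsub : ∑ j, (T.x j.succ - T.x j.castSucc) • Function.update w i u j -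
      ∑ j, (T.x j.succ - T.x j.castSucc) • Function.update w i v j =
      (1 / (n.succ : ℝ)) • (u - v) := by
    rw [← Finset.sum_sub_distrib, Finset.sum_eq_single i]
    · rw [← smul_sub, hlen]
      simp
    · intro j _ hj
      simp [hj]
    · simp
  have hd : ‖(1 / (n.succ : ℝ)) • (u - v)‖ ≤ Metric.diam A + 2 := by
    rw [← hsub, ← dist_eq_norm]
    rw [dist_comm] at hbv
    linarith [dist_triangle4 (∑ j, (T.x j.succ - T.x j.castSucc) • Function.update w i u j) a b
      (∑ j, (T.x j.succ - T.x j.castSucc) • Function.update w i v j)]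
  have hpos : (0 : ℝ) < n.succ := by exact_mod_cast n.succ_pos
  rw [norm_smul, Real.norm_of_nonneg (by positivity), one_div, inv_mul_le_iff₀ hpos] at hd
  exact hd

/-- Points near a compact set are controlled in norm by finitely many functionals. -/
theorem IsCompact.exists_finset_dual_norm_lt {K : Set X} (hK : IsCompact K) {ε : ℝ}
    (hε : 0 < ε) :
    ∃ S : Finset (X →L[ℝ] ℝ), (∀ f ∈ S, ‖f‖ ≤ 1) ∧
      ∀ z, (∃ k ∈ K, dist z k < ε) → (∀ f ∈ S, |f z| < ε) → ‖z‖ < 5 * ε := by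
  classical
  obtain ⟨N, -, hNfin, hN⟩ := hK.finite_cover_balls hε
  choose f hf1 hf using fun c : X => exists_dual_vector'' ℝ c
  refine ⟨hNfin.toFinset.image f, ?_, ?_⟩
  · simp only [Finset.mem_image]
    rintro _ ⟨c, -, rfl⟩
    exact hf1 c
  · rintro z ⟨k, hk, hzk⟩ hz
    obtain ⟨c, hc, hkc⟩ := Set.mem_iUnion₂.1 (hN hk)
    have hfz := hz (f c) (Finset.mem_image_of_mem _ (hNfin.mem_toFinset.2 hc))
    have hzc : ‖z - c‖ < 2 * ε := by
      rw [← dist_eq_norm]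
      linarith [dist_triangle z k c, Metric.mem_ball.1 hkc]
    have h1 : |f c (z - c)| ≤ ‖z - c‖ := by
      simpa using (f c).le_of_opNorm_le (hf1 c) (z - c)
    have h2 : f c c = ‖c‖ := hf c
    have h3 : ‖z‖ ≤ ‖z - c‖ + ‖c‖ := norm_le_norm_sub_add z c
    rw [map_sub, h2] at h1
    linarith [abs_le.1 h1, abs_lt.1 hfz]

/-- A point of a convex hull does not lie strictly below the generating set. -/
theorem exists_le_of_mem_convexHull {C : Set X} {y : X} (hy : y ∈ convexHull ℝ C)
    (g : X →ₗ[ℝ] ℝ) : ∃ x ∈ C, g x ≤ g y := by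
  by_contra! h
  exact lt_irrefl (g y)
    (convexHull_min (t := {x | g y < g x}) h (convex_halfSpace_gt g.isLinear _) hy)

/-- Points of convex hulls can be replaced by points of the generating sets, with quadratic
control on finitely many functionals applied to the resulting error in a linear combination. -/
theorem exists_selection_sum_sq_le {ι : Type*} (s : Finset ι) (C : ι → Set X) (y : ι → X)
    (hy : ∀ i, y i ∈ convexHull ℝ (C i)) (r : ι → ℝ) (hr : ∀ i, 0 ≤ r i) (M : ℝ)
    (hM : ∀ i, ∀ x ∈ C i, ‖x - y i‖ ≤ M) (S : Finset (X →L[ℝ] ℝ)) (hS : ∀ f ∈ S, ‖f‖ ≤ 1) :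
    ∃ x : ι → X, (∀ i, x i ∈ C i) ∧
      ∑ f ∈ S, (f (∑ i ∈ s, r i • (x i - y i))) ^ 2 ≤ S.card * M ^ 2 * ∑ i ∈ s, r i ^ 2 := by
  classical
  induction s using Finset.induction_on with
  | empty =>
    choose x hx using fun i => convexHull_nonempty_iff.1 ⟨y i, hy i⟩
    exact ⟨x, hx, by simp⟩
  | insert j s hj ih =>
    obtain ⟨x, hx, hxs⟩ := ih
    set z := ∑ i ∈ s, r i • (x i - y i) with hz
    let g : X →L[ℝ] ℝ := ∑ f ∈ S, f z • f
    obtain ⟨v, hv, hgv⟩ := exists_le_of_mem_convexHull (hy j) g.toLinearMap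
    have hg : ∑ f ∈ S, f z * f (v - y j) ≤ 0 := by
      have : g (v - y j) ≤ 0 := by
        rw [map_sub]
        exact sub_nonpos.2 hgv
      simpa [g] using this
    refine ⟨Function.update x j v, fun i => ?_, ?_⟩
    · rcases eq_or_ne i j with rfl | hij
      · simpa using hv
      · simpa [hij] using hx i
    · have hsum : ∑ i ∈ s, r i • (Function.update x j v i - y i) = z :=
        Finset.sum_congr rfl fun i hi => by
          rw [Function.update_of_ne (ne_of_mem_of_not_mem hi hj)]
      have hsq : ∑ f ∈ S, (f (v - y j)) ^ 2 ≤ S.card * M ^ 2 := by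
        rw [← nsmul_eq_mul]
        refine Finset.sum_le_card_nsmul _ _ _ fun f hf => ?_
        have h1 : |f (v - y j)| ≤ M :=
          ((f.le_of_opNorm_le (hS f hf) _).trans_eq (one_mul _)).trans (hM j v hv)
        exact sq_le_sq' (abs_le.1 h1).1 (abs_le.1 h1).2
      rw [Finset.sum_insert hj, Finset.sum_insert hj, hsum, Function.update_self]
      calc ∑ f ∈ S, (f (r j • (v - y j) + z)) ^ 2
          = r j ^ 2 * ∑ f ∈ S, (f (v - y j)) ^ 2 + 2 * r j * ∑ f ∈ S, f z * f (v - y j)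
            + ∑ f ∈ S, (f z) ^ 2 := by
            simp only [Finset.mul_sum, ← Finset.sum_add_distrib]
            refine Finset.sum_congr rfl fun f _ => ?_
            rw [map_add, map_smul, smul_eq_mul]
            ring
        _ ≤ r j ^ 2 * (S.card * M ^ 2) + 0 + S.card * M ^ 2 * ∑ i ∈ s, r i ^ 2 := by
            refine add_le_add (add_le_add (mul_le_mul_of_nonneg_left hsq (sq_nonneg _)) ?_) hxs
            exact mul_nonpos_of_nonneg_of_nonpos (mul_nonneg zero_le_two (hr j)) hg
        _ = S.card * M ^ 2 * (r j ^ 2 + ∑ i ∈ s, r i ^ 2) := by ring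

end

/-- In any Banach space, if `conv F` is Riemann integrable with compact integral `A`,
then `F` is Riemann integrable with the same integral `A`. -/
theorem stmt15 {X : Type*} [NormedAddCommGroup X] [NormedSpace ℝ X] [CompleteSpace X]
    (F : ℝ → Set X) (hF : IsMultifunction F) (A : Set X)
    (hFA : IsSetRiemannIntegral (fun t => convexHull ℝ (F t)) A) (hAcomp : IsCompact A) :
    IsSetRiemannIntegral F A := by
  obtain ⟨M, hM⟩ := hFA.exists_forall_norm_sub_le hF.convexHull
  obtain ⟨hne, hcl, hb, hA⟩ := hFA
  refine ⟨hne, hcl, hb, fun ε hε => ?_⟩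
  obtain ⟨η, hη, rfl⟩ : ∃ η, 0 < η ∧ ε = 12 * η := ⟨ε / 12, by positivity, by ring⟩
  obtain ⟨S, hS, hSK⟩ :=
    (hAcomp.add hAcomp.neg).exists_finset_dual_norm_lt (mul_pos two_pos hη)
  obtain ⟨δ, hδ, hA⟩ := hA η hη
  set c : ℝ := S.card * M ^ 2 with hc
  have hc0 : 0 ≤ c := by positivity
  refine ⟨min δ ((2 * η) ^ 2 / (c + 1)), by positivity, fun T hT => ?_⟩
  have hTA := hA T (hT.trans_le (min_le_left _ _))
  have hfin := hF.convexHull.hausdorffEDist_setRiemannSum_ne_top hne hb T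
  have hsub : ∀ z ∈ setRiemannSum F T, z ∈ setRiemannSum (fun t => convexHull ℝ (F t)) T := by
    intro z hz
    obtain ⟨y, hy, rfl⟩ := mem_setRiemannSum.1 hz
    exact mem_setRiemannSum.2 ⟨y, fun i => subset_convexHull ℝ _ (hy i), rfl⟩
  suffices h : Metric.hausdorffDist (setRiemannSum F T) A ≤ 11 * η by linarith
  refine Metric.hausdorffDist_le_of_mem_dist (by positivity) (fun z hz => ?_) fun a ha => ?_
  · obtain ⟨a, ha, hza⟩ := Metric.exists_dist_lt_of_hausdorffDist_lt (hsub z hz) hTA hfin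
    exact ⟨a, ha, by linarith⟩
  · obtain ⟨q, hq, hqa⟩ := Metric.exists_dist_lt_of_hausdorffDist_lt' ha hTA hfin
    obtain ⟨y, hy, rfl⟩ := mem_setRiemannSum.1 hq
    obtain ⟨x, hx, hxy⟩ := exists_selection_sum_sq_le Finset.univ (fun i => F (T.t i)) y hy _
      T.length_nonneg M
      (fun i x hx => hM _ (T.tag_mem_unitInterval i) x (subset_convexHull ℝ _ hx) _ (hy i)) S hS
    have hp := mem_setRiemannSum.2 ⟨x, hx, rfl⟩
    refine ⟨_, hp, ?_⟩
    obtain ⟨b, hbA, hpb⟩ := Metric.exists_dist_lt_of_hausdorffDist_lt (hsub _ hp) hTA hfin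
    simp only [smul_sub, Finset.sum_sub_distrib] at hxy
    set p := ∑ i, (T.x i.succ - T.x i.castSucc) • x i
    set q := ∑ i, (T.x i.succ - T.x i.castSucc) • y i
    have hpq : ‖p - q‖ < 5 * (2 * η) := by
      refine hSK _ ⟨b - a, by simpa [sub_eq_add_neg] using Set.add_mem_add hbA (Set.neg_mem_neg.2 ha), ?_⟩ fun f hf => ?_
      · linarith [dist_sub_sub_le p q b a]
      · refine abs_lt_of_sq_lt_sq ?_ (by positivity)
        calc (f (p - q)) ^ 2 ≤ ∑ f ∈ S, (f (p - q)) ^ 2 :=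
              Finset.single_le_sum (f := fun f : X →L[ℝ] ℝ => (f (p - q)) ^ 2)
                (fun f _ => sq_nonneg _) hf
          _ ≤ c * T.mesh :=
              hxy.trans (mul_le_mul_of_nonneg_left T.sum_length_sq_le_mesh hc0)
          _ ≤ c * ((2 * η) ^ 2 / (c + 1)) :=
              mul_le_mul_of_nonneg_left (hT.le.trans (min_le_right _ _)) hc0
          _ < (2 * η) ^ 2 := by
              rw [mul_div_assoc', div_lt_iff₀ (by positivity)]
              nlinarith [sq_pos_of_pos (mul_pos two_pos hη)]
    rw [← dist_eq_norm, dist_comm] at hpq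
    rw [dist_comm] at hqa
    linarith [dist_triangle a q p]
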